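/- arXiv:2401.05816 — 4 statements merged into one kernel-verified Lean document; each statement's English description precedes it below -/
import Mathlib

section
/- Fix an integer e ≥ 2 and κ = (κ₁, κ₂) ∈ (ℤ/eℤ)². Let λ and μ be bipartitions with |λ| = |μ|. Then the content of λ equals the content of μ (as multisets) if and only if δ_i(λ) = δ_i(μ) for every i ∈ ℤ/eℤ. -/
namespace Wt3

/-- `f : ℕ → ℕ` (0-indexed: `f r` is the `(r+1)`-th part `λ_{r+1}`) is a partition if it is
weakly decreasing with finitely many nonzero terms. -/
def IsPartition (f : ℕ → ℕ) : Prop :=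
  (∀ r, f (r + 1) ≤ f r) ∧ ∃ N, ∀ r, N ≤ r → f r = 0

/-- A bipartition: an ordered pair of partitions, given as `lam : Fin 2 → ℕ → ℕ`. -/
def IsBipartition (lam : Fin 2 → ℕ → ℕ) : Prop := ∀ a, IsPartition (lam a)

/-- Nodes `(r, c, a)` with 0-indexed row `r`, column `c`, and component `a : Fin 2`. -/
abbrev Node := ℕ × ℕ × Fin 2

/-- The Young diagram of a bipartition: `(r,c,a)` is a node iff `c < λ⁽ᵃ⁾_r` (0-indexed,
corresponding to `c+1 ≤ λ⁽ᵃ⁾_{r+1}` in 1-indexed terms). -/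
def Diagram (lam : Fin 2 → ℕ → ℕ) : Set Node := {x | x.2.1 < lam x.2.2 x.1}

/-- A node of `[λ]` is removable if deleting it leaves the Young diagram of a bipartition. -/
def IsRemovable (lam : Fin 2 → ℕ → ℕ) (x : Node) : Prop :=
  x ∈ Diagram lam ∧ ∃ mu, IsBipartition mu ∧ Diagram mu = Diagram lam \ {x}

/-- A node not in `[λ]` is addable if adding it gives the Young diagram of a bipartition. -/
def IsAddable (lam : Fin 2 → ℕ → ℕ) (x : Node) : Prop :=
  x ∉ Diagram lam ∧ ∃ mu, IsBipartition mu ∧ Diagram mu = Diagram lam ∪ {x}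

/-- The residue `c − r + κ_a ∈ ℤ/eℤ` of a node `(r,c,a)` (0-indexing leaves this unchanged). -/
def res (e : ℕ) (κ : Fin 2 → ZMod e) (x : Node) : ZMod e :=
  (x.2.1 : ZMod e) - (x.1 : ZMod e) + κ x.2.2

/-- `c_i(λ)`: the number of `i`-nodes of `λ`. -/
noncomputable def cnt (e : ℕ) (κ : Fin 2 → ZMod e) (lam : Fin 2 → ℕ → ℕ) (i : ZMod e) : ℕ :=
  Set.ncard {x : Node | x ∈ Diagram lam ∧ res e κ x = i}

/-- The number of removable `i`-nodes of `λ`. -/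
noncomputable def remCount (e : ℕ) (κ : Fin 2 → ZMod e) (lam : Fin 2 → ℕ → ℕ) (i : ZMod e) : ℕ :=
  Set.ncard {x : Node | IsRemovable lam x ∧ res e κ x = i}

/-- The number of addable `i`-nodes of `λ`. -/
noncomputable def addCount (e : ℕ) (κ : Fin 2 → ZMod e) (lam : Fin 2 → ℕ → ℕ) (i : ZMod e) : ℕ :=
  Set.ncard {x : Node | IsAddable lam x ∧ res e κ x = i}

/-- `δ_i(λ)`: number of removable `i`-nodes minus number of addable `i`-nodes. -/
noncomputable def delta (e : ℕ) (κ : Fin 2 → ZMod e) (lam : Fin 2 → ℕ → ℕ) (i : ZMod e) : ℤ :=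
  (remCount e κ lam i : ℤ) - (addCount e κ lam i : ℤ)

/-- The weight `wt(λ) = c_{κ₁}(λ) + c_{κ₂}(λ) − ½ Σ_{i ∈ ℤ/eℤ} (c_i(λ) − c_{i+1}(λ))²`. -/
noncomputable def wt (e : ℕ) (κ : Fin 2 → ZMod e) (lam : Fin 2 → ℕ → ℕ) : ℚ :=
  (cnt e κ lam (κ 0) : ℚ) + (cnt e κ lam (κ 1) : ℚ) -
    (1 / 2) * ∑ j ∈ Finset.range e,
      ((cnt e κ lam (j : ZMod e) : ℚ) - (cnt e κ lam ((j : ZMod e) + 1) : ℚ)) ^ 2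

/-- The rim of `λ`: nodes `(r,c,a) ∈ [λ]` with `(r+1,c+1,a) ∉ [λ]`. -/
def Rim (lam : Fin 2 → ℕ → ℕ) : Set Node :=
  {x | x ∈ Diagram lam ∧ (x.1 + 1, x.2.1 + 1, x.2.2) ∉ Diagram lam}

/-- One step along a strip: `y` is one step to the right of, or one step above, `x`
(in the same component). -/
def Step (x y : Node) : Prop :=
  y.2.2 = x.2.2 ∧ ((y.1 = x.1 ∧ y.2.1 = x.2.1 + 1) ∨ (x.1 = y.1 + 1 ∧ y.2.1 = x.2.1))

/-- A rim hook of `λ`: a nonempty subset of the rim, contained in a single component,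
forming a connected strip, whose removal leaves the Young diagram of a bipartition. -/
def IsRimHook (lam : Fin 2 → ℕ → ℕ) (H : Finset Node) : Prop :=
  H.Nonempty ∧ ↑H ⊆ Rim lam ∧ (∀ x ∈ H, ∀ y ∈ H, x.2.2 = y.2.2) ∧
    (∃ l : List Node, l.Chain' Step ∧ ∀ x : Node, x ∈ l ↔ x ∈ H) ∧
    ∃ mu, IsBipartition mu ∧ Diagram mu = Diagram lam \ ↑H

/-- A bicore: a bipartition with no rim `e`-hooks. -/
def IsBicore (e : ℕ) (lam : Fin 2 → ℕ → ℕ) : Prop :=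
  ¬ ∃ H : Finset Node, IsRimHook lam H ∧ H.card = e

/-- The beta-set `{λ_r + k − r : 1 ≤ r ≤ k}` of a partition with charge `k` (0-indexed form). -/
def betaSet (f : ℕ → ℕ) (k : ℕ) : Finset ℕ :=
  (Finset.range k).image fun r => f r + (k - (r + 1))

/-- The number of nonzero parts of a partition. -/
noncomputable def len (f : ℕ → ℕ) : ℕ := Set.ncard {r : ℕ | f r ≠ 0}

/-- `(k₁,k₂)` is a bicharge for `κ` relative to `λ`. -/
def IsBicharge (e : ℕ) (κ : Fin 2 → ZMod e) (lam : Fin 2 → ℕ → ℕ) (k₁ k₂ : ℕ) : Prop :=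
  (k₁ : ZMod e) = κ 0 ∧ (k₂ : ZMod e) = κ 1 ∧ len (lam 0) ≤ k₁ ∧ len (lam 1) ≤ k₂

/-- `γ_x(λ)`: beads of residue `x` in the first beta-set minus those in the second. -/
def gamma (e : ℕ) (lam : Fin 2 → ℕ → ℕ) (k₁ k₂ : ℕ) (x : ZMod e) : ℤ :=
  (((betaSet (lam 0) k₁).filter fun b : ℕ => (b : ZMod e) = x).card : ℤ) -
    (((betaSet (lam 1) k₂).filter fun b : ℕ => (b : ZMod e) = x).card : ℤ)

/-- `x` is above (higher than) `y`. -/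
def Above (x y : Node) : Prop := x.2.2 < y.2.2 ∨ (x.2.2 = y.2.2 ∧ x.1 < y.1)

/-- A normal `i`-node: a removable `i`-node `x` such that for every addable `i`-node `y`
below `x`, the removable `i`-nodes strictly between `x` and `y` outnumber the addable ones
(equivalently, the `−` sign of `x` survives in the reduced `i`-signature). -/
def IsNormal (e : ℕ) (κ : Fin 2 → ZMod e) (lam : Fin 2 → ℕ → ℕ) (i : ZMod e) (x : Node) :
    Prop :=
  IsRemovable lam x ∧ res e κ x = i ∧
    ∀ y : Node, IsAddable lam y → res e κ y = i → Above x y →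
      Set.ncard {z : Node | IsAddable lam z ∧ res e κ z = i ∧ Above x z ∧ Above z y} <
        Set.ncard {z : Node | IsRemovable lam z ∧ res e κ z = i ∧ Above x z ∧ Above z y}

/-- The good `i`-node: the highest normal `i`-node. -/
def IsGood (e : ℕ) (κ : Fin 2 → ZMod e) (lam : Fin 2 → ℕ → ℕ) (i : ZMod e) (x : Node) :
    Prop :=
  IsNormal e κ lam i x ∧ ∀ y, IsNormal e κ lam i y → y = x ∨ Above x y

/-- An antinormal `i`-node: a removable `i`-node `x` such that for every addable `i`-node `y`
above `x`, the removable `i`-nodes strictly between `y` and `x` outnumber the addable ones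
(equivalently, the `−` sign of `x` survives in the antireduced `i`-signature). -/
def IsAntinormal (e : ℕ) (κ : Fin 2 → ZMod e) (lam : Fin 2 → ℕ → ℕ) (i : ZMod e) (x : Node) :
    Prop :=
  IsRemovable lam x ∧ res e κ x = i ∧
    ∀ y : Node, IsAddable lam y → res e κ y = i → Above y x →
      Set.ncard {z : Node | IsAddable lam z ∧ res e κ z = i ∧ Above y z ∧ Above z x} <
        Set.ncard {z : Node | IsRemovable lam z ∧ res e κ z = i ∧ Above y z ∧ Above z x}

/-- The antigood `i`-node: the lowest antinormal `i`-node. -/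
def IsAntigood (e : ℕ) (κ : Fin 2 → ZMod e) (lam : Fin 2 → ℕ → ℕ) (i : ZMod e) (x : Node) :
    Prop :=
  IsAntinormal e κ lam i x ∧ ∀ y, IsAntinormal e κ lam i y → y = x ∨ Above y x

/-- `μ →ᵢ λ`: `μ` is obtained from `λ` by removing the good `i`-node. -/
def RemGoodAt (e : ℕ) (κ : Fin 2 → ZMod e) (i : ZMod e) (mu lam : Fin 2 → ℕ → ℕ) : Prop :=
  ∃ x, IsGood e κ lam i x ∧ Diagram mu = Diagram lam \ {x}

/-- `μ ⇒ᵢ λ`: `μ` is obtained from `λ` by removing the antigood `i`-node. -/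
def RemAntigoodAt (e : ℕ) (κ : Fin 2 → ZMod e) (i : ZMod e) (mu lam : Fin 2 → ℕ → ℕ) : Prop :=
  ∃ x, IsAntigood e κ lam i x ∧ Diagram mu = Diagram lam \ {x}

/-- `μ → λ`: `μ` is obtained from the bipartition `λ` by removing a good node. -/
def RemGood (e : ℕ) (κ : Fin 2 → ZMod e) (mu lam : Fin 2 → ℕ → ℕ) : Prop :=
  IsBipartition mu ∧ IsBipartition lam ∧ ∃ i, RemGoodAt e κ i mu lam

/-- A bipartition is restricted if it lies in the class of the empty bipartition under the
equivalence relation generated by `→`. -/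
def IsRestricted (e : ℕ) (κ : Fin 2 → ZMod e) (lam : Fin 2 → ℕ → ℕ) : Prop :=
  Relation.EqvGen (RemGood e κ) lam (fun _ _ => 0)

/-- A partition is `e`-restricted if `λ_r − λ_{r+1} < e` for all `r`. -/
def IsERestricted (e : ℕ) (f : ℕ → ℕ) : Prop := ∀ r, f r < f (r + 1) + e

/-- The conjugate partition: `λ′_r = #{c : λ_c ≥ r}` (0-indexed form). -/
noncomputable def conjP (f : ℕ → ℕ) : ℕ → ℕ := fun r => Set.ncard {c : ℕ | r + 1 ≤ f c}

/-- The conjugate bipartition `λ′ = ((λ⁽²⁾)′ | (λ⁽¹⁾)′)`. -/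
noncomputable def conjB (lam : Fin 2 → ℕ → ℕ) : Fin 2 → ℕ → ℕ := fun a => conjP (lam (1 - a))

/-- `|λ|` for a partition. -/
noncomputable def psize (f : ℕ → ℕ) : ℕ := Set.ncard {p : ℕ × ℕ | p.2 < f p.1}

/-- `|λ|` for a bipartition. -/
noncomputable def bsize (lam : Fin 2 → ℕ → ℕ) : ℕ := psize (lam 0) + psize (lam 1)

/-- `λ_1 + ⋯ + λ_r`. -/
def psum (f : ℕ → ℕ) (r : ℕ) : ℕ := ∑ j ∈ Finset.range r, f j

/-- The dominance order on bipartitions: `λ ⊵ μ`. -/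
def Dominates (lam mu : Fin 2 → ℕ → ℕ) : Prop :=
  ∀ r : ℕ, psum (mu 0) r ≤ psum (lam 0) r ∧
    psize (mu 0) + psum (mu 1) r ≤ psize (lam 0) + psum (lam 1) r

/-! Single-partition versions (for statement 11). -/

abbrev Node1 := ℕ × ℕ

def Diagram1 (f : ℕ → ℕ) : Set Node1 := {x | x.2 < f x.1}

def IsRemovable1 (f : ℕ → ℕ) (x : Node1) : Prop :=
  x ∈ Diagram1 f ∧ ∃ g, IsPartition g ∧ Diagram1 g = Diagram1 f \ {x}

def IsAddable1 (f : ℕ → ℕ) (x : Node1) : Prop :=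
  x ∉ Diagram1 f ∧ ∃ g, IsPartition g ∧ Diagram1 g = Diagram1 f ∪ {x}

def res1 (e : ℕ) (k : ZMod e) (x : Node1) : ZMod e := (x.2 : ZMod e) - (x.1 : ZMod e) + k

def Rim1 (f : ℕ → ℕ) : Set Node1 := {x | x ∈ Diagram1 f ∧ (x.1 + 1, x.2 + 1) ∉ Diagram1 f}

def Step1 (x y : Node1) : Prop :=
  (y.1 = x.1 ∧ y.2 = x.2 + 1) ∨ (x.1 = y.1 + 1 ∧ y.2 = x.2)

def IsRimHook1 (f : ℕ → ℕ) (H : Finset Node1) : Prop :=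
  H.Nonempty ∧ ↑H ⊆ Rim1 f ∧
    (∃ l : List Node1, l.Chain' Step1 ∧ ∀ x : Node1, x ∈ l ↔ x ∈ H) ∧
    ∃ g, IsPartition g ∧ Diagram1 g = Diagram1 f \ ↑H

/-- An `e`-core: a partition with no rim `e`-hooks. -/
def IsECore (e : ℕ) (f : ℕ → ℕ) : Prop := ¬ ∃ H : Finset Node1, IsRimHook1 f H ∧ H.card = e

/-! The statement. -/

/-- The removable nodes are the ends of the rows strictly longer than the next row. -/
theorem isRemovable_iff {lam : Fin 2 → ℕ → ℕ} (hlam : IsBipartition lam) (r c : ℕ) (a : Fin 2) :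
    IsRemovable lam (r, c, a) ↔ lam a r = c + 1 ∧ lam a (r + 1) < lam a r := by
  constructor
  · rintro ⟨hx, mu, hmu, hD⟩
    have key (s d : ℕ) : d < mu a s ↔ d < lam a s ∧ ¬(s = r ∧ d = c) := by
      simpa [Diagram] using Set.ext_iff.1 hD (s, d, a)
    have hx' : c < lam a r := hx
    have h1 := key r c
    have h2 := key r (c + 1)
    have h3 := key (r + 1) c
    have h4 := (hmu a).1 r
    grind
  · rintro ⟨h1, h2⟩
    refine ⟨by simp [Diagram, h1], fun b s => if b = a ∧ s = r then c else lam b s, ?_, ?_⟩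
    · intro b
      obtain ⟨hdec, N, hN⟩ := hlam b
      refine ⟨fun s => ?_, N + r + 1, fun s hs => ?_⟩
      · have := hdec s
        grind
      · have := hN s (by omega)
        grind
    · ext ⟨s, d, b⟩
      simp only [Diagram, Set.mem_ofPred_eq, Set.mem_sdiff, Set.mem_singleton_iff, Prod.mk.injEq]
      grind

/-- The addable nodes extend the first row and the rows strictly shorter than the previous row. -/
theorem isAddable_iff {lam : Fin 2 → ℕ → ℕ} (hlam : IsBipartition lam) (r c : ℕ) (a : Fin 2) :
    IsAddable lam (r, c, a) ↔ lam a r = c ∧ ∀ s, r = s + 1 → lam a r < lam a s := by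
  constructor
  · rintro ⟨hx, mu, hmu, hD⟩
    have key (s d : ℕ) : d < mu a s ↔ d < lam a s ∨ (s = r ∧ d = c) := by
      have := Set.ext_iff.1 hD (s, d, a)
      simp only [Diagram, Set.mem_ofPred_eq, Set.mem_union, Set.mem_singleton_iff,
        Prod.mk.injEq, and_true] at this
      exact this
    have hx' : ¬ c < lam a r := hx
    have h1 := key r c
    have h2 := key r (c - 1)
    have hc : lam a r = c := by grind
    refine ⟨hc, ?_⟩
    rintro s rfl
    have h3 := key s c
    have h4 := (hmu a).1 s
    grind
  · rintro ⟨h1, h2⟩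
    refine ⟨by simp [Diagram, h1], fun b s => if b = a ∧ s = r then c + 1 else lam b s, ?_, ?_⟩
    · intro b
      obtain ⟨hdec, N, hN⟩ := hlam b
      refine ⟨fun s => ?_, N + r + 1, fun s hs => ?_⟩
      · have := hdec s
        have := h2 s
        grind
      · have := hN s (by omega)
        grind
    · ext ⟨s, d, b⟩
      simp only [Diagram, Set.mem_ofPred_eq, Set.mem_union, Set.mem_singleton_iff, Prod.mk.injEq]
      grind

open Classical in
theorem ncard_pair_eq_sum (P : ℕ × ℕ → Prop) (N M : ℕ) (hP : ∀ r c, P (r, c) → r < N ∧ c < M) :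
    (Set.ncard {p | P p} : ℤ) =
      ∑ r ∈ Finset.range N, ∑ c ∈ Finset.range M, if P (r, c) then 1 else 0 := by
  have h : {p | P p} = ↑((Finset.range N ×ˢ Finset.range M).filter P) := by
    ext ⟨r, c⟩
    simpa using hP r c
  rw [h, Set.ncard_coe_finset, Finset.card_filter, Finset.sum_product]
  push_cast
  rfl

open Classical in
theorem ncard_node_eq_sum (P : Node → Prop) (N M : ℕ)
    (hP : ∀ r c a, P (r, c, a) → r < N ∧ c < M) :
    (Set.ncard {x | P x} : ℤ) =
      ∑ a, ∑ r ∈ Finset.range N, ∑ c ∈ Finset.range M, if P (r, c, a) then 1 else 0 := by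
  have h : {x | P x} =
      ↑((Finset.range N ×ˢ Finset.range M ×ˢ (Finset.univ : Finset (Fin 2))).filter P) := by
    ext ⟨r, c, a⟩
    simpa using hP r c a
  rw [h, Set.ncard_coe_finset, Finset.card_filter, Finset.sum_product]
  push_cast
  rw [Finset.sum_comm (s := Finset.univ)]
  refine Finset.sum_congr rfl fun r _ => ?_
  rw [Finset.sum_product, Finset.sum_comm]

theorem IsPartition.le_zero {f : ℕ → ℕ} (hf : IsPartition f) (r : ℕ) : f r ≤ f 0 :=
  antitone_nat_of_succ_le hf.1 (Nat.zero_le r)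

/-- Common bounds on the number of rows and columns of both components of a bipartition. -/
theorem IsBipartition.exists_bounds {lam : Fin 2 → ℕ → ℕ} (hlam : IsBipartition lam) :
    ∃ N M, (∀ a r, N ≤ r → lam a r = 0) ∧ ∀ a r, lam a r ≤ M := by
  choose N hN using fun a => (hlam a).2
  refine ⟨N 0 + N 1, lam 0 0 + lam 1 0, fun a r hr => hN a r ?_, fun a r => ?_⟩
  · fin_cases a <;> simp <;> omega
  · have := (hlam a).le_zero r
    fin_cases a <;> simp at * <;> omega

theorem sum_range_ite_lt {M n : ℕ} (hn : n ≤ M) (F : ℕ → ℤ) :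
    ∑ c ∈ Finset.range M, (if c < n then F c else 0) = ∑ c ∈ Finset.range n, F c := by
  have h : Finset.range n = (Finset.range M).filter (· < n) := by
    ext c
    simp
    omega
  rw [h, Finset.sum_filter]

/-- Summing the second difference of `g` over the contents of the nodes of a partition leaves the
removable nodes, the addable nodes and the origin. -/
theorem sum_second_difference {f : ℕ → ℕ} (N : ℕ) (hdec : ∀ r, f (r + 1) ≤ f r) (hN : f N = 0)
    (g : ℤ → ℤ) :
    ∑ r ∈ Finset.range N, ∑ c ∈ Finset.range (f r),
        (2 * g (c - r) - g (c - r - 1) - g (c - r + 1)) =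
      (∑ r ∈ Finset.range N, if f (r + 1) < f r then g (f r - 1 - r) else 0) -
        ((∑ r ∈ Finset.range N, if f (r + 1) < f r then g (f (r + 1) - (r + 1)) else 0) + g (f 0)) +
        g 0 := by
  have hrow (n : ℕ) (z : ℤ) : ∑ c ∈ Finset.range n,
      (2 * g (c - z) - g (c - z - 1) - g (c - z + 1)) =
        g (n - 1 - z) - g (n - z) + (g (-z) - g (-z - 1)) := by
    induction n with
    | zero => simp; ring_nf
    | succ n ih =>
      rw [Finset.sum_range_succ, ih]
      push_cast
      ring_nf
  simp only [hrow]
  have hgen (K : ℕ) : ∑ r ∈ Finset.range K,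
      (g (f r - 1 - r) - g (f r - r) + (g (-r) - g (-r - 1))) =
      (∑ r ∈ Finset.range K, if f (r + 1) < f r then g (f r - 1 - r) else 0) -
        ((∑ r ∈ Finset.range K, if f (r + 1) < f r then g (f (r + 1) - (r + 1)) else 0) + g (f 0)) +
        g 0 + g (f K - K) - g (-K) := by
    induction K with
    | zero => simp
    | succ K ih =>
      rw [Finset.sum_range_succ, ih, Finset.sum_range_succ, Finset.sum_range_succ]
      have h1 : (f (K : ℕ) - 1 - K : ℤ) = f K - (K + 1) := by ring
      have h2 : (-K - 1 : ℤ) = -(K + 1) := by ring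
      push_cast
      rcases (hdec K).lt_or_eq with h | h
      · simp only [h, if_true, h2]
        ring
      · simp only [h, lt_irrefl, if_false, h1, h2]
        ring
  rw [hgen, hN]
  simp

theorem cnt_eq_sum (e : ℕ) (κ : Fin 2 → ZMod e) {lam : Fin 2 → ℕ → ℕ} {N M : ℕ}
    (hN : ∀ a r, N ≤ r → lam a r = 0) (hM : ∀ a r, lam a r ≤ M) (i : ZMod e) :
    (cnt e κ lam i : ℤ) = ∑ a, ∑ r ∈ Finset.range N, ∑ c ∈ Finset.range (lam a r),
      if (c - r + κ a : ZMod e) = i then 1 else 0 := by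
  classical
  rw [cnt, ncard_node_eq_sum _ N M]
  · refine Finset.sum_congr rfl fun a _ => Finset.sum_congr rfl fun r _ => ?_
    rw [← sum_range_ite_lt (hM a r)]
    refine Finset.sum_congr rfl fun c _ => ?_
    by_cases h : c < lam a r <;> simp [Diagram, res, h]
  · rintro r c a ⟨h, -⟩
    have h' : c < lam a r := h
    have := hN a r
    have := hM a r
    omega

theorem psize_eq_sum {f : ℕ → ℕ} {N M : ℕ} (hN : ∀ r, N ≤ r → f r = 0) (hM : ∀ r, f r ≤ M) :
    (psize f : ℤ) = ∑ r ∈ Finset.range N, (f r : ℤ) := by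
  classical
  rw [psize, ncard_pair_eq_sum _ N M]
  · refine Finset.sum_congr rfl fun r _ => ?_
    refine Eq.trans ?_ ((sum_range_ite_lt (hM r) fun _ => 1).trans (by simp))
    refine Finset.sum_congr rfl fun c _ => ?_
    by_cases h : c < f r <;> simp [h]
  · intro r c h
    have h' : c < f r := h
    have := hN r
    have := hM r
    omega

theorem sum_cnt (e : ℕ) [NeZero e] (κ : Fin 2 → ZMod e) {lam : Fin 2 → ℕ → ℕ}
    (hlam : IsBipartition lam) : ∑ i, (cnt e κ lam i : ℤ) = bsize lam := by
  obtain ⟨N, M, hN, hM⟩ := hlam.exists_bounds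
  simp only [cnt_eq_sum e κ hN hM]
  rw [bsize, Nat.cast_add, psize_eq_sum (hN 0) (hM 0), psize_eq_sum (hN 1) (hM 1),
    ← Fin.sum_univ_two (fun a => ∑ r ∈ Finset.range N, (lam a r : ℤ)), Finset.sum_comm]
  refine Finset.sum_congr rfl fun a _ => ?_
  rw [Finset.sum_comm]
  refine Finset.sum_congr rfl fun r _ => ?_
  rw [Finset.sum_comm]
  simp

theorem remCount_eq_sum (e : ℕ) (κ : Fin 2 → ZMod e) {lam : Fin 2 → ℕ → ℕ}
    (hlam : IsBipartition lam) {N M : ℕ}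
    (hN : ∀ a r, N ≤ r → lam a r = 0) (hM : ∀ a r, lam a r ≤ M) (i : ZMod e) :
    (remCount e κ lam i : ℤ) = ∑ a, ∑ r ∈ Finset.range N, if lam a (r + 1) < lam a r then
      (if (lam a r - 1 - r + κ a : ZMod e) = i then 1 else 0) else 0 := by
  classical
  rw [remCount, ncard_node_eq_sum _ N M]
  · refine Finset.sum_congr rfl fun a _ => Finset.sum_congr rfl fun r _ => ?_
    have hMr := hM a r
    simp only [isRemovable_iff hlam, res]
    rw [Finset.sum_eq_single (lam a r - 1)]
    · by_cases h : lam a (r + 1) < lam a r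
      · have hpos : lam a r = lam a r - 1 + 1 := by omega
        have hcast : ((lam a r - 1 : ℕ) : ZMod e) = lam a r - 1 := by
          rw [Nat.cast_sub (by omega), Nat.cast_one]
        simp only [h, ← hpos, hcast, true_and, if_true]
      · simp [h]
    · grind
    · grind
  · rintro r c a ⟨h, -⟩
    have := ((isRemovable_iff hlam r c a).1 h).1
    have := hN a r
    have := hM a r
    omega

theorem addCount_eq_sum (e : ℕ) (κ : Fin 2 → ZMod e) {lam : Fin 2 → ℕ → ℕ}
    (hlam : IsBipartition lam) {N M : ℕ}
    (hN : ∀ a r, N ≤ r → lam a r = 0) (hM : ∀ a r, lam a r ≤ M) (i : ZMod e) :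
    (addCount e κ lam i : ℤ) = ∑ a, ((∑ r ∈ Finset.range N, if lam a (r + 1) < lam a r then
      (if (lam a (r + 1) - (r + 1) + κ a : ZMod e) = i then 1 else 0) else 0) +
        if (lam a 0 + κ a : ZMod e) = i then 1 else 0) := by
  classical
  rw [addCount, ncard_node_eq_sum _ (N + 1) (M + 1)]
  · refine Finset.sum_congr rfl fun a _ => ?_
    simp only [isAddable_iff hlam, res]
    have hrow (r : ℕ) (P : Prop) : (∑ c ∈ Finset.range (M + 1),
        if (lam a r = c ∧ P) ∧ (c - r + κ a : ZMod e) = i then (1 : ℤ) else 0) =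
        if P then (if (lam a r - r + κ a : ZMod e) = i then 1 else 0) else 0 := by
      have hMr := hM a r
      rw [Finset.sum_eq_single (lam a r)]
      · grind
      · grind
      · grind
    simp only [hrow]
    rw [Finset.sum_range_succ']
    simp
  · rintro r c a ⟨h, -⟩
    obtain ⟨h1, h2⟩ := (isAddable_iff hlam r c a).1 h
    have := hM a r
    refine ⟨?_, by omega⟩
    rcases r with _ | r
    · omega
    · have := h2 r rfl
      have := hN a r
      omega

/-- Each `δ_i` is an affine function of the content. -/
theorem delta_eq (e : ℕ) (κ : Fin 2 → ZMod e) {lam : Fin 2 → ℕ → ℕ}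
    (hlam : IsBipartition lam) (i : ZMod e) :
    delta e κ lam i = 2 * cnt e κ lam i - cnt e κ lam (i + 1) - cnt e κ lam (i - 1) -
      ∑ a, if κ a = i then 1 else 0 := by
  obtain ⟨N, M, hN, hM⟩ := hlam.exists_bounds
  rw [delta, remCount_eq_sum e κ hlam hN hM, addCount_eq_sum e κ hlam hN hM]
  simp only [cnt_eq_sum e κ hN hM, Finset.mul_sum, ← Finset.sum_sub_distrib]
  refine Finset.sum_congr rfl fun a _ => ?_
  have h := sum_second_difference N (hlam a).1 (hN a N le_rfl)
    (fun z => if (z + κ a : ZMod e) = i then 1 else 0)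
  have h1 (x : ZMod e) : x - 1 + κ a = i ↔ x + κ a = i + 1 := by
    constructor <;> intro h <;> linear_combination h
  have h2 (x : ZMod e) : x + 1 + κ a = i ↔ x + κ a = i - 1 := by
    constructor <;> intro h <;> linear_combination h
  push_cast at h
  simp only [zero_add] at h
  simp only [← h1, ← h2]
  rw [h]
  ring

/-- A discrete harmonic function on a cycle is constant. -/
theorem eq_of_harmonic {e : ℕ} [NeZero e] (d : ZMod e → ℤ)
    (hd : ∀ i, 2 * d i = d (i + 1) + d (i - 1)) (i j : ZMod e) : d i = d j := by
  obtain ⟨m, hm⟩ := Finite.exists_max d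
  have hstep (n : ℕ) : d (m + n) = d m := by
    induction n with
    | zero => simp
    | succ n ih =>
      have h := hd (m + n)
      have h1 := hm (m + n + 1)
      have h2 := hm (m + n - 1)
      push_cast
      rw [← add_assoc]
      omega
  have hall (x : ZMod e) : d x = d m := by
    simpa using hstep (x - m).val
  rw [hall i, hall j]

theorem stmt1 (e : ℕ) (he : 2 ≤ e) (κ : Fin 2 → ZMod e) (lam mu : Fin 2 → ℕ → ℕ)
    (hlam : IsBipartition lam) (hmu : IsBipartition mu) (hsize : bsize lam = bsize mu) :
    (∀ i : ZMod e, cnt e κ lam i = cnt e κ mu i) ↔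
      (∀ i : ZMod e, delta e κ lam i = delta e κ mu i) := by
  have : NeZero e := ⟨by omega⟩
  simp only [delta_eq e κ hlam, delta_eq e κ hmu]
  constructor
  · intro h i
    simp only [h]
  · intro h
    have hconst := eq_of_harmonic (fun i => (cnt e κ lam i : ℤ) - cnt e κ mu i) fun i => by
      linear_combination h i
    have hsum : ∑ i, ((cnt e κ lam i : ℤ) - cnt e κ mu i) = 0 := by
      rw [Finset.sum_sub_distrib, sum_cnt e κ hlam, sum_cnt e κ hmu, hsize, sub_self]
    intro i
    rw [Finset.sum_congr rfl fun j _ => hconst j i] at hsum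
    simp only [Finset.sum_const, Finset.card_univ, ZMod.card, nsmul_eq_mul,
      mul_eq_zero, Nat.cast_eq_zero] at hsum
    omega

end Wt3
end

section
/- Fix an integer e ≥ 2 and κ = (κ₁, κ₂) ∈ (ℤ/eℤ)². If λ is a restricted bipartition (with respect to e and κ), then both components λ⁽¹⁾ and λ⁽²⁾ are e-restricted partitions. -/
namespace Wt3

/-! Removing a good node neither creates nor destroys a gap of size at least `e`. -/

lemma finite_diagram {lam : Fin 2 → ℕ → ℕ} (h : IsBipartition lam) : (Diagram lam).Finite := by
  choose N hN using fun a => (h a).2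
  refine (Set.finite_iUnion fun a => ((Set.finite_lt_nat (N a)).biUnion fun r _ =>
    (Set.finite_lt_nat (lam a r)).image fun c => ((r, c, a) : Node))).subset ?_
  rintro ⟨r, c, a⟩ hx
  change c < lam a r at hx
  have hr : r < N a := by
    by_contra! hr
    have := hN a r hr
    omega
  simp only [Set.mem_iUnion]
  exact ⟨a, r, hr, c, hx, rfl⟩

lemma isRemovable_of_lt {lam : Fin 2 → ℕ → ℕ} (h : IsBipartition lam) {r c : ℕ} {a : Fin 2}
    (hc : lam a r = c + 1) (hr : lam a (r + 1) ≤ c) : IsRemovable lam (r, c, a) := by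
  refine ⟨show c < lam a r by omega, fun b s => if b = a ∧ s = r then c else lam b s, ?_, ?_⟩
  · intro b
    obtain ⟨hmono, N, hN⟩ := h b
    refine ⟨fun s => ?_, N, fun s hs => ?_⟩
    · have := hmono s
      grind
    · have := hN s hs
      grind
  · ext ⟨s, k, b⟩
    simp only [Diagram, Set.mem_ofPred_eq, Set.mem_sdiff, Set.mem_singleton_iff, Prod.mk.injEq]
    grind

lemma isAddable_of_lt {lam : Fin 2 → ℕ → ℕ} (h : IsBipartition lam) {r : ℕ} {a : Fin 2}
    (hr : lam a (r + 1) < lam a r) : IsAddable lam (r + 1, lam a (r + 1), a) := by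
  refine ⟨lt_irrefl (lam a (r + 1)),
    fun b s => if b = a ∧ s = r + 1 then lam a (r + 1) + 1 else lam b s, ?_, ?_⟩
  · intro b
    obtain ⟨hmono, N, hN⟩ := h b
    refine ⟨fun s => ?_, max N (r + 2), fun s hs => ?_⟩
    · have := hmono s
      grind
    · have := hN s (by omega)
      grind
  · ext ⟨s, k, b⟩
    simp only [Diagram, Set.mem_ofPred_eq, Set.mem_union, Set.mem_singleton_iff, Prod.mk.injEq]
    grind

lemma IsAddable.col_eq {lam : Fin 2 → ℕ → ℕ} {r c : ℕ} {a : Fin 2}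
    (h : IsAddable lam (r, c, a)) : c = lam a r := by
  obtain ⟨hx, mu, -, hmu⟩ := h
  have key : ∀ k, k < mu a r ↔ k < lam a r ∨ k = c := fun k => by
    simpa [Diagram, or_comm] using Set.ext_iff.mp hmu (r, k, a)
  have hx : ¬ c < lam a r := hx
  have h₁ := key c
  have h₂ := key (lam a r)
  omega

/-- The effect on row lengths of deleting a node from the Young diagram. -/
lemma row_eq_of_diagram_eq {mu lam : Fin 2 → ℕ → ℕ} {r c : ℕ} {a : Fin 2}
    (hx : (r, c, a) ∈ Diagram lam) (h : Diagram mu = Diagram lam \ {(r, c, a)}) :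
    lam a r = c + 1 ∧ mu a r = c ∧ ∀ b s, ¬ (b = a ∧ s = r) → mu b s = lam b s := by
  have key : ∀ b s k, k < mu b s ↔ k < lam b s ∧ ¬ (s = r ∧ k = c ∧ b = a) := fun b s k => by
    simpa [Diagram] using Set.ext_iff.mp h (s, k, b)
  have hx : c < lam a r := hx
  have h₁ := key a r c
  have h₂ := key a r (mu a r)
  have h₃ := key a r (c + 1)
  have h₄ := key a r (c - 1)
  refine ⟨by grind, by grind, fun b s hbs => ?_⟩
  have h₅ := key b s (mu b s)
  have h₆ := key b s (lam b s)
  grind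

/-- A removable `i`-node in the row directly above a normal `i`-node is normal. -/
lemma IsNormal.of_succ_row {e : ℕ} (he : 2 ≤ e) {κ : Fin 2 → ZMod e} {lam : Fin 2 → ℕ → ℕ}
    (h : IsBipartition lam) {i : ZMod e} {r c d : ℕ} {a : Fin 2} (hc : lam a (r + 1) = c + 1)
    (hx : IsNormal e κ lam i (r + 1, c, a)) (hrem : IsRemovable lam (r, d, a))
    (hres : res e κ (r, d, a) = i) : IsNormal e κ lam i (r, d, a) := by
  obtain ⟨-, hxres, hx⟩ := hx
  have : Fact (1 < e) := ⟨he⟩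
  have below : ∀ y, IsAddable lam y → res e κ y = i → Above (r, d, a) y →
      Above (r + 1, c, a) y := by
    rintro ⟨s, k, b⟩ hy hyi hab
    rcases hab with hab | ⟨hab, hrs⟩
    · exact Or.inl hab
    · refine Or.inr ⟨hab, show r + 1 < s from ?_⟩
      replace hab : a = b := hab
      replace hrs : r < s := hrs
      subst hab
      refine lt_of_le_of_ne hrs fun hs => ?_
      subst hs
      have hk := hy.col_eq
      subst hk
      rw [← hxres] at hyi
      simp [res, hc] at hyi
  have above : ∀ z, Above (r + 1, c, a) z → Above (r, d, a) z := by
    rintro ⟨s, k, b⟩ (hz | ⟨hz, hs⟩)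
    · exact Or.inl hz
    · exact Or.inr ⟨hz, Nat.lt_of_succ_lt hs⟩
  refine ⟨hrem, hres, fun y hy hyi hab => ?_⟩
  refine lt_of_le_of_lt (le_of_eq ?_) (lt_of_lt_of_le (hx y hy hyi (below y hy hyi hab))
    (Set.ncard_le_ncard ?_ ?_))
  · congr 1
    ext z
    exact ⟨fun ⟨h₁, h₂, h₃, h₄⟩ => ⟨h₁, h₂, below z h₁ h₂ h₃, h₄⟩,
      fun ⟨h₁, h₂, h₃, h₄⟩ => ⟨h₁, h₂, above z h₃, h₄⟩⟩
  · exact fun z ⟨h₁, h₂, h₃, h₄⟩ => ⟨h₁, h₂, above z h₃, h₄⟩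
  · exact (finite_diagram h).subset fun z hz => hz.1.1

lemma RemGood.isERestricted_iff {e : ℕ} (he : 2 ≤ e) {κ : Fin 2 → ZMod e}
    {mu lam : Fin 2 → ℕ → ℕ} (h : RemGood e κ mu lam) :
    (∀ a, IsERestricted e (mu a)) ↔ ∀ a, IsERestricted e (lam a) := by
  obtain ⟨-, hlam, i, ⟨r, c, a⟩, ⟨hnormal, hhigh⟩, hdiag⟩ := h
  obtain ⟨hc, hmuc, hmu⟩ := row_eq_of_diagram_eq hnormal.1.1 hdiag
  constructor
  · intro hrestr b s
    have hs := hrestr b s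
    by_contra hcon
    have hbs : b = a ∧ s = r := by
      by_contra hne
      have h₁ := hmu b s hne
      by_cases hne' : b = a ∧ s + 1 = r
      · obtain ⟨rfl, rfl⟩ := hne'
        omega
      · have h₂ := hmu b (s + 1) hne'
        omega
    obtain ⟨rfl, rfl⟩ := hbs
    have hsucc := hmu b (s + 1) (by simp)
    have hgap : c + 1 = lam b (s + 1) + e := by omega
    have hgap' : (c : ZMod e) + 1 = lam b (s + 1) := by
      simpa using congrArg (Nat.cast : ℕ → ZMod e) hgap
    have hres : res e κ (s + 1, lam b (s + 1), b) = i := by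
      rw [← hnormal.2.1]
      simp only [res, ← hgap']
      push_cast
      ring
    have hlt := hnormal.2.2 _ (isAddable_of_lt hlam (by omega)) hres
      (Or.inr ⟨rfl, Nat.lt_succ_self s⟩)
    refine (Nat.zero_le _).not_gt (lt_of_lt_of_eq hlt ?_)
    convert Set.ncard_empty Node
    ext ⟨t, k, b'⟩
    simp only [Above, Set.mem_ofPred_eq, Set.mem_empty_iff_false, iff_false]
    rintro ⟨-, -, h₁ | ⟨h₀, h₁⟩, h₂ | ⟨h₃, h₂⟩⟩ <;> omega
  · intro hrestr b s
    have hs := hrestr b s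
    have hmono := (hlam a).1 r
    by_contra hcon
    have hbs : b = a ∧ s + 1 = r := by
      by_contra hne
      have h₁ := hmu b (s + 1) hne
      by_cases hne' : b = a ∧ s = r
      · obtain ⟨rfl, rfl⟩ := hne'
        omega
      · have h₂ := hmu b s hne'
        omega
    obtain ⟨rfl, rfl⟩ := hbs
    have hsame := hmu b s (by simp)
    have hrow : lam b s = (c + e - 1) + 1 := by omega
    have hres : res e κ (s, c + e - 1, b) = i := by
      rw [← hnormal.2.1]
      have : ((c + e - 1 : ℕ) : ZMod e) + 1 = c := by
        have h₁ : c + e - 1 + 1 = c + e := by omega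
        simpa using congrArg (Nat.cast : ℕ → ZMod e) h₁
      simp only [res, ← this]
      push_cast
      ring
    have hn := hnormal.of_succ_row he hlam hc (isRemovable_of_lt hlam hrow (by omega)) hres
    rcases hhigh _ hn with heq | hab | ⟨-, hab⟩
    · simp at heq
    · exact lt_irrefl _ hab
    · exact (Nat.lt_succ_self s).asymm hab

/-! The statement. -/

theorem stmt2 (e : ℕ) (he : 2 ≤ e) (κ : Fin 2 → ZMod e) (lam : Fin 2 → ℕ → ℕ)
    (hlam : IsBipartition lam) (hres : IsRestricted e κ lam) :
    ∀ a : Fin 2, IsERestricted e (lam a) := by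
  suffices h : ∀ mu nu : Fin 2 → ℕ → ℕ, Relation.EqvGen (RemGood e κ) mu nu →
      ((∀ a, IsERestricted e (mu a)) ↔ ∀ a, IsERestricted e (nu a)) from
    (h _ _ hres).2 fun _ _ => show 0 < 0 + e by omega
  intro mu nu hmn
  induction hmn with
  | rel _ _ h => exact h.isERestricted_iff he
  | refl _ => exact Iff.rfl
  | symm _ _ _ ih => exact ih.symm
  | trans _ _ _ _ _ ih₁ ih₂ => exact ih₁.trans ih₂

end Wt3
end

section
/- Fix an integer e ≥ 2 and κ = (κ₁, κ₂) ∈ (ℤ/eℤ)². Let λ and μ be bipartitions and i ∈ ℤ/eℤ, and set i′ = κ₁ + κ₂ − i. Then μ ⇒ᵢ λ (μ is obtained from λ by removing the antigood i-node) if and only if μ′ →_{i′} λ′ (μ′ is obtained from λ′ by removing the good i′-node), where all signature notions for λ′ and μ′ are taken with respect to the same e and κ. -/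
namespace Wt3

theorem IsPartition.antitone {f : ℕ → ℕ} (hf : IsPartition f) : Antitone f :=
  antitone_nat_of_succ_le hf.1

theorem lt_conjP_iff {f : ℕ → ℕ} (hf : IsPartition f) (r c : ℕ) :
    r < conjP f c ↔ c < f r := by
  classical
  have hex : ∃ k, f k < c + 1 := by
    obtain ⟨N, hN⟩ := hf.2
    exact ⟨N, by simp [hN N le_rfl]⟩
  have hset : {k : ℕ | c + 1 ≤ f k} = ↑(Finset.range (Nat.find hex)) := by
    ext k
    simp only [Set.mem_ofPred_eq, Finset.coe_range, Set.mem_Iio, Nat.lt_find_iff, not_lt]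
    exact ⟨fun h m hm => h.trans (hf.antitone hm), fun h => h k le_rfl⟩
  have hmem : r ∈ {k : ℕ | c + 1 ≤ f k} ↔ r < Nat.find hex := by
    rw [hset, Finset.mem_coe, Finset.mem_range]
  rw [conjP, hset, Set.ncard_coe_finset, Finset.card_range, ← hmem]
  exact Iff.rfl

theorem IsPartition.conjP {f : ℕ → ℕ} (hf : IsPartition f) : IsPartition (conjP f) := by
  refine ⟨fun c => ?_, f 0, fun c hc => ?_⟩
  · by_contra! h
    have h1 := (lt_conjP_iff hf _ _).1 h
    exact lt_irrefl _ ((lt_conjP_iff hf _ _).2 ((Nat.lt_succ_self c).trans h1))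
  · by_contra h
    exact hc.not_gt ((lt_conjP_iff hf _ _).1 (Nat.pos_of_ne_zero h))

theorem IsBipartition.conjB {lam : Fin 2 → ℕ → ℕ} (h : IsBipartition lam) :
    IsBipartition (conjB lam) := fun a => (h (1 - a)).conjP

/-- The transposition of nodes corresponding to conjugation of bipartitions. -/
def transp (x : Node) : Node := (x.2.1, x.1, 1 - x.2.2)

@[simp] theorem transp_transp (x : Node) : transp (transp x) = x := by
  simp [transp]

theorem transp_injective : Function.Injective transp :=
  Function.LeftInverse.injective transp_transp

theorem diagram_conjB {lam : Fin 2 → ℕ → ℕ} (h : IsBipartition lam) :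
    Diagram (conjB lam) = transp ⁻¹' Diagram lam := by
  ext x
  exact lt_conjP_iff (h (1 - x.2.2)) _ _

theorem diagram_injective : Function.Injective Diagram := by
  intro lam mu h
  funext a r
  have key : ∀ c, c < lam a r ↔ c < mu a r := fun c => Set.ext_iff.1 h (r, c, a)
  exact le_antisymm (not_lt.1 fun h' => lt_irrefl _ ((key _).1 h'))
    (not_lt.1 fun h' => lt_irrefl _ ((key _).2 h'))

theorem conjB_conjB {lam : Fin 2 → ℕ → ℕ} (h : IsBipartition lam) :
    conjB (conjB lam) = lam := by
  apply diagram_injective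
  rw [diagram_conjB h.conjB, diagram_conjB h]
  ext x
  simp

theorem IsBipartition.mem_diagram_of_le {lam : Fin 2 → ℕ → ℕ} (h : IsBipartition lam)
    {r c r' c' : ℕ} {a : Fin 2} (hx : (r, c, a) ∈ Diagram lam) (hr : r' ≤ r) (hc : c' ≤ c) :
    (r', c', a) ∈ Diagram lam :=
  hc.trans_lt (lt_of_lt_of_le (show c < lam a r from hx) ((h a).antitone hr))

theorem preimage_transp_singleton (x : Node) : transp ⁻¹' {x} = {transp x} := by
  ext y
  simp only [Set.mem_preimage, Set.mem_singleton_iff]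
  constructor <;> rintro rfl <;> simp

theorem diagram_eq_diff_iff {lam mu : Fin 2 → ℕ → ℕ} (hlam : IsBipartition lam)
    (hmu : IsBipartition mu) (x : Node) :
    Diagram (conjB mu) = Diagram (conjB lam) \ {transp x} ↔
      Diagram mu = Diagram lam \ {x} := by
  rw [diagram_conjB hlam, diagram_conjB hmu, ← preimage_transp_singleton, ← Set.preimage_sdiff]
  exact (Function.Involutive.surjective transp_transp).preimage_injective.eq_iff

theorem IsRemovable.conjB {lam : Fin 2 → ℕ → ℕ} (h : IsBipartition lam) {x : Node}
    (hx : IsRemovable lam x) : IsRemovable (conjB lam) (transp x) := by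
  obtain ⟨hx, mu, hmu, hd⟩ := hx
  refine ⟨by simpa [diagram_conjB h] using hx, _, hmu.conjB, ?_⟩
  exact (diagram_eq_diff_iff h hmu x).2 hd

theorem IsAddable.conjB {lam : Fin 2 → ℕ → ℕ} (h : IsBipartition lam) {x : Node}
    (hx : IsAddable lam x) : IsAddable (conjB lam) (transp x) := by
  obtain ⟨hx, mu, hmu, hd⟩ := hx
  refine ⟨by simpa [diagram_conjB h] using hx, _, hmu.conjB, ?_⟩
  rw [diagram_conjB h, diagram_conjB hmu, hd, Set.preimage_union, preimage_transp_singleton]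

theorem isRemovable_conjB_transp {lam : Fin 2 → ℕ → ℕ} (h : IsBipartition lam) (x : Node) :
    IsRemovable (conjB lam) (transp x) ↔ IsRemovable lam x :=
  ⟨fun hx => by simpa [conjB_conjB h] using hx.conjB h.conjB, fun hx => hx.conjB h⟩

theorem isAddable_conjB_transp {lam : Fin 2 → ℕ → ℕ} (h : IsBipartition lam) (x : Node) :
    IsAddable (conjB lam) (transp x) ↔ IsAddable lam x :=
  ⟨fun hx => by simpa [conjB_conjB h] using hx.conjB h.conjB, fun hx => hx.conjB h⟩

theorem res_transp (e : ℕ) (κ : Fin 2 → ZMod e) (x : Node) :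
    res e κ (transp x) = κ 0 + κ 1 - res e κ x := by
  obtain ⟨r, c, a⟩ := x
  fin_cases a <;> simp [res, transp] <;> ring

theorem res_transp_eq_iff (e : ℕ) (κ : Fin 2 → ZMod e) (i : ZMod e) (x : Node) :
    res e κ (transp x) = κ 0 + κ 1 - i ↔ res e κ x = i := by
  rw [res_transp, sub_right_inj]

/-- All nodes strictly north-west of `x` lie in the diagram and all nodes strictly south-east
of `x` lie outside it. -/
def IsCorner (lam : Fin 2 → ℕ → ℕ) (x : Node) : Prop :=
  (∀ r c, r ≤ x.1 → c ≤ x.2.1 → (r, c, x.2.2) ≠ x → (r, c, x.2.2) ∈ Diagram lam) ∧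
    ∀ r c, x.1 ≤ r → x.2.1 ≤ c → (r, c, x.2.2) ≠ x → (r, c, x.2.2) ∉ Diagram lam

theorem IsRemovable.isCorner {lam : Fin 2 → ℕ → ℕ} (h : IsBipartition lam) {x : Node}
    (hx : IsRemovable lam x) : IsCorner lam x := by
  obtain ⟨hx, mu, hmu, hd⟩ := hx
  refine ⟨fun r c hr hc _ => h.mem_diagram_of_le hx hr hc, fun r c hr hc hne hmem => ?_⟩
  have hm : (r, c, x.2.2) ∈ Diagram mu := hd ▸ ⟨hmem, hne⟩
  have hxm : x ∈ Diagram mu := hmu.mem_diagram_of_le hm hr hc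
  rw [hd] at hxm
  exact hxm.2 rfl

theorem IsAddable.isCorner {lam : Fin 2 → ℕ → ℕ} (h : IsBipartition lam) {x : Node}
    (hx : IsAddable lam x) : IsCorner lam x := by
  obtain ⟨hx, mu, hmu, hd⟩ := hx
  refine ⟨fun r c hr hc hne => ?_, fun r c hr hc _ hmem => hx (h.mem_diagram_of_le hmem hr hc)⟩
  have hxm : x ∈ Diagram mu := hd ▸ Or.inr rfl
  have hm : (r, c, x.2.2) ∈ Diagram mu := hmu.mem_diagram_of_le hxm hr hc
  rw [hd] at hm
  exact hm.resolve_right hne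

theorem IsCorner.col_lt_iff_row_lt {e : ℕ} (he : 2 ≤ e) {κ : Fin 2 → ZMod e}
    {lam : Fin 2 → ℕ → ℕ} {r c s d : ℕ} {a : Fin 2} (hx : IsCorner lam (r, c, a))
    (hy : IsCorner lam (s, d, a)) (hres : res e κ (r, c, a) = res e κ (s, d, a)) :
    d < c ↔ r < s := by
  have : Fact (1 < e) := ⟨he⟩
  simp only [IsCorner, ne_eq, Prod.mk.injEq, and_true] at hx hy
  constructor
  · intro hdc
    by_contra! hsr
    by_cases h : s = r ∧ d + 1 = c
    · obtain ⟨rfl, rfl⟩ := h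
      simp [res] at hres
    · exact hy.2 s (d + 1) le_rfl (by omega) (by omega) (hx.1 s (d + 1) hsr hdc h)
  · intro hrs
    by_contra! hcd
    by_cases h : r + 1 = s ∧ c = d
    · obtain ⟨rfl, rfl⟩ := h
      simp [res] at hres
    · exact hx.2 (r + 1) c (by omega) le_rfl (by omega) (hy.1 (r + 1) c hrs hcd h)

theorem IsCorner.above_transp {e : ℕ} (he : 2 ≤ e) {κ : Fin 2 → ZMod e}
    {lam : Fin 2 → ℕ → ℕ} {x y : Node} (hx : IsCorner lam x) (hy : IsCorner lam y)
    (hres : res e κ x = res e κ y) : Above (transp y) (transp x) ↔ Above x y := by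
  obtain ⟨r, c, a⟩ := x
  obtain ⟨s, d, b⟩ := y
  by_cases hab : a = b
  · subst hab
    simpa [Above, transp] using hx.col_lt_iff_row_lt he hy hres
  · fin_cases a <;> fin_cases b <;> simp_all [Above, transp]

theorem ncard_transp_between {e : ℕ} (he : 2 ≤ e) {κ : Fin 2 → ZMod e}
    {lam : Fin 2 → ℕ → ℕ} {i : ZMod e} {P Q : Node → Prop}
    (hPQ : ∀ z, Q (transp z) ↔ P z) (hP : ∀ z, P z → IsCorner lam z) {x y : Node}
    (hx : IsCorner lam x) (hy : IsCorner lam y) (hxi : res e κ x = i) (hyi : res e κ y = i) :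
    Set.ncard {z : Node | Q z ∧ res e κ z = κ 0 + κ 1 - i ∧
      Above (transp x) z ∧ Above z (transp y)} =
    Set.ncard {z : Node | P z ∧ res e κ z = i ∧ Above y z ∧ Above z x} := by
  rw [← Set.ncard_image_of_injective {z : Node | P z ∧ res e κ z = i ∧ Above y z ∧ Above z x}
    transp_injective]
  congr 1
  ext w
  obtain ⟨z, rfl⟩ : ∃ z, transp z = w := ⟨transp w, transp_transp w⟩
  rw [transp_injective.mem_set_image]
  simp only [Set.mem_ofPred_eq, hPQ, res_transp_eq_iff]
  refine and_congr_right fun hz => and_congr_right fun hzi => ?_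
  rw [(hP z hz).above_transp he hx (hzi.trans hxi.symm),
    hy.above_transp he (hP z hz) (hyi.trans hzi.symm), and_comm]

theorem isNormal_conjB_transp {e : ℕ} (he : 2 ≤ e) {κ : Fin 2 → ZMod e}
    {lam : Fin 2 → ℕ → ℕ} (h : IsBipartition lam) (i : ZMod e) (x : Node) :
    IsNormal e κ (conjB lam) (κ 0 + κ 1 - i) (transp x) ↔ IsAntinormal e κ lam i x := by
  rw [IsNormal, IsAntinormal, isRemovable_conjB_transp h, res_transp_eq_iff]
  refine and_congr_right fun hx => and_congr_right fun hxi => ?_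
  rw [(Function.Involutive.surjective transp_transp).forall]
  refine forall_congr' fun y => ?_
  rw [isAddable_conjB_transp h, res_transp_eq_iff]
  refine forall_congr' fun hy => forall_congr' fun hyi => ?_
  have hxc := hx.isCorner h
  have hyc := hy.isCorner h
  rw [hyc.above_transp he hxc (hyi.trans hxi.symm),
    ncard_transp_between he (isAddable_conjB_transp h) (fun z hz => hz.isCorner h) hxc hyc hxi hyi,
    ncard_transp_between he (isRemovable_conjB_transp h) (fun z hz => hz.isCorner h)
      hxc hyc hxi hyi]

theorem isGood_conjB_transp {e : ℕ} (he : 2 ≤ e) {κ : Fin 2 → ZMod e}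
    {lam : Fin 2 → ℕ → ℕ} (h : IsBipartition lam) (i : ZMod e) (x : Node) :
    IsGood e κ (conjB lam) (κ 0 + κ 1 - i) (transp x) ↔ IsAntigood e κ lam i x := by
  rw [IsGood, IsAntigood, isNormal_conjB_transp he h]
  refine and_congr_right fun hx => ?_
  rw [(Function.Involutive.surjective transp_transp).forall]
  refine forall_congr' fun y => ?_
  rw [isNormal_conjB_transp he h]
  refine forall_congr' fun hy => ?_
  rw [transp_injective.eq_iff, (hy.1.isCorner h).above_transp he (hx.1.isCorner h)
    (hy.2.1.trans hx.2.1.symm)]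

/-! The statement. -/

theorem stmt4 (e : ℕ) (he : 2 ≤ e) (κ : Fin 2 → ZMod e) (lam mu : Fin 2 → ℕ → ℕ)
    (hlam : IsBipartition lam) (hmu : IsBipartition mu) (i : ZMod e) :
    RemAntigoodAt e κ i mu lam ↔
      RemGoodAt e κ (κ 0 + κ 1 - i) (conjB mu) (conjB lam) := by
  refine Iff.trans (exists_congr fun x => ?_)
    (Function.Involutive.surjective transp_transp).exists.symm
  rw [isGood_conjB_transp he hlam, diagram_eq_diff_iff hlam hmu]

end Wt3
end

section
/- Fix an integer e ≥ 2 and κ = (κ₁, κ₂) ∈ (ℤ/eℤ)². For every bipartition λ, the weight wt(λ) = c_{κ₁}(λ) + c_{κ₂}(λ) − (1/2) Σ_{i ∈ ℤ/eℤ} (c_i(λ) − c_{i+1}(λ))² is a non-negative integer. -/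
namespace Wt3

/-! The statement. -/

open Finset in
/-- A finite set of `n` natural numbers has sum at least `0 + 1 + ⋯ + (n - 1)`. -/
lemma card_mul_card_sub_one_le_two_mul_sum (S : Finset ℕ) :
    (#S : ℤ) * (#S - 1) ≤ 2 * ∑ x ∈ S, (x : ℤ) := by
  induction S using Finset.induction_on_max with
  | empty => simp
  | insert a S ha ih =>
    have hnot : a ∉ S := fun h => lt_irrefl _ (ha a h)
    have hcard : #S ≤ a := by
      simpa using Finset.card_le_card (fun x hx => Finset.mem_range.2 (ha x hx) : S ⊆ range a)
    rw [Finset.card_insert_of_notMem hnot, Finset.sum_insert hnot]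
    push_cast
    have : (#S : ℤ) ≤ a := by exact_mod_cast hcard
    nlinarith

/-- Shifting by one matches the `j < n` of residue `i` with the `0 < j ≤ n` of residue `i + 1`. -/
lemma card_residue_succ (e : ℕ) (i : ZMod e) (n : ℕ) :
    (∑ j ∈ Finset.range (n + 1), if (j : ZMod e) = i + 1 then (1 : ℤ) else 0) =
      (∑ j ∈ Finset.range n, if (j : ZMod e) = i then (1 : ℤ) else 0) +
        if i + 1 = 0 then 1 else 0 := by
  rw [Finset.sum_range_succ']
  simp [eq_comm]

lemma card_residue_sub (e : ℕ) (i : ZMod e) (n : ℕ) :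
    (∑ j ∈ Finset.range (n + 1), if (j : ZMod e) = i then (1 : ℤ) else 0) -
      (∑ j ∈ Finset.range (n + 1), if (j : ZMod e) = i + 1 then (1 : ℤ) else 0) =
      (if (n : ZMod e) = i then 1 else 0) - if i + 1 = 0 then 1 else 0 := by
  rw [card_residue_succ, Finset.sum_range_succ]
  ring

lemma card_residue_zero (e : ℕ) (n : ℕ) :
    (∑ j ∈ Finset.range (n + 1), if (j : ZMod e) = 0 then (1 : ℤ) else 0) = (n / e : ℕ) + 1 := by
  induction n with
  | zero => rw [Finset.sum_range_one]; simp
  | succ n ih =>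
    rw [Finset.sum_range_succ, ih, Nat.succ_div]
    simp only [ZMod.natCast_eq_zero_iff]
    split_ifs <;> push_cast <;> ring

/-- The number of nodes of residue `i` in the first `N` rows of the partition `f`, with charge
`0`. -/
def rowCnt (e : ℕ) (f : ℕ → ℕ) (N : ℕ) (i : ZMod e) : ℤ :=
  ∑ r ∈ Finset.range N, ∑ c ∈ Finset.range (f r), if (c : ZMod e) - r = i then (1 : ℤ) else 0

/-- The `r`-th beta number of `f` with charge `N`. -/
def beta (f : ℕ → ℕ) (N r : ℕ) : ℕ := f r + (N - 1 - r)

lemma row_eq_sub (e : ℕ) (f : ℕ → ℕ) {N r : ℕ} (hN : (N : ZMod e) = 0) (hr : r < N)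
    (i : ZMod e) :
    (∑ c ∈ Finset.range (f r), if (c : ZMod e) - r = i then (1 : ℤ) else 0) =
      (∑ j ∈ Finset.range (beta f N r + 1), if (j : ZMod e) = i then (1 : ℤ) else 0) -
      ∑ j ∈ Finset.range (N - 1 - r + 1), if (j : ZMod e) = i then (1 : ℤ) else 0 := by
  have h : beta f N r + 1 = (N - 1 - r + 1) + f r := by unfold beta; ring
  rw [h, Finset.sum_range_add, add_sub_cancel_left]
  refine Finset.sum_congr rfl fun c _ => ?_
  have h2 : N - 1 - r + 1 + c + r = N + c := by omega
  have h3 : ((N - 1 - r + 1 + c : ℕ) : ZMod e) = c - r := by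
    rw [eq_sub_iff_add_eq]
    have := congrArg (Nat.cast : ℕ → ZMod e) h2
    push_cast [hN] at this ⊢
    simpa using this
  rw [h3]

lemma rowCnt_zero (e : ℕ) (f : ℕ → ℕ) {N : ℕ} (hN : (N : ZMod e) = 0) :
    rowCnt e f N 0 =
      ∑ r ∈ Finset.range N, ((beta f N r / e : ℕ) : ℤ) -
        ∑ j ∈ Finset.range N, ((j / e : ℕ) : ℤ) := by
  rw [← Finset.sum_range_reflect (fun j => ((j / e : ℕ) : ℤ)), ← Finset.sum_sub_distrib]
  refine Finset.sum_congr rfl fun r hr => ?_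
  rw [row_eq_sub e f hN (Finset.mem_range.1 hr), card_residue_zero, card_residue_zero]
  ring

lemma rowCnt_sub (e : ℕ) (f : ℕ → ℕ) {N : ℕ} (hN : (N : ZMod e) = 0) (i : ZMod e) :
    rowCnt e f N i - rowCnt e f N (i + 1) =
      (∑ r ∈ Finset.range N, if (beta f N r : ZMod e) = i then (1 : ℤ) else 0) -
        ∑ j ∈ Finset.range N, if (j : ZMod e) = i then (1 : ℤ) else 0 := by
  rw [← Finset.sum_range_reflect (fun j => if (j : ZMod e) = i then (1 : ℤ) else 0),
    ← Finset.sum_sub_distrib, rowCnt, rowCnt, ← Finset.sum_sub_distrib]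
  refine Finset.sum_congr rfl fun r hr => ?_
  rw [row_eq_sub e f hN (Finset.mem_range.1 hr), row_eq_sub e f hN (Finset.mem_range.1 hr)]
  have h1 := card_residue_sub e i (beta f N r)
  have h2 := card_residue_sub e i (N - 1 - r)
  linarith

lemma beta_injOn {f : ℕ → ℕ} (hf : IsPartition f) (N : ℕ) :
    Set.InjOn (beta f N) (Finset.range N) := by
  have hanti : Antitone f := antitone_nat_of_succ_le hf.1
  have hlt : ∀ r s, r < s → s < N → beta f N s < beta f N r := by
    intro r s hrs hs
    have := hanti hrs.le
    unfold beta
    omega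
  intro r hr s hs h
  simp only [Finset.coe_range, Set.mem_Iio] at hr hs
  rcases lt_trichotomy r s with h1 | h1 | h1
  · exact absurd h (hlt r s h1 hs).ne'
  · exact h1
  · exact absurd h (hlt s r h1 hr).ne

lemma sum_range_mul_residue (e : ℕ) [NeZero e] (M : ℕ) (i : ZMod e) :
    (∑ j ∈ Finset.range (e * M), if (j : ZMod e) = i then (1 : ℤ) else 0) = M := by
  induction M with
  | zero => simp
  | succ M ih =>
    rw [mul_add, mul_one, Finset.sum_range_add, ih]
    have hs :
        (∑ x ∈ Finset.range e, if ((e * M + x : ℕ) : ZMod e) = i then (1 : ℤ) else 0) = 1 := by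
      rw [Finset.sum_eq_single i.val]
      · simp
      · intro b hb hne
        rw [if_neg]
        intro h
        apply hne
        rw [← h]
        simp [ZMod.val_natCast, Nat.mod_eq_of_lt (Finset.mem_range.1 hb)]
      · intro h
        exact absurd (Finset.mem_range.2 (ZMod.val_lt i)) h
    rw [hs]
    push_cast
    ring

lemma two_mul_sum_range_mul_div (e : ℕ) [NeZero e] (M : ℕ) :
    2 * (∑ j ∈ Finset.range (e * M), ((j / e : ℕ) : ℤ)) = e * (M * (M - 1)) := by
  induction M with
  | zero => simp
  | succ M ih =>
    rw [mul_add, mul_one, Finset.sum_range_add, mul_add, ih]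
    have hs : (∑ x ∈ Finset.range e, (((e * M + x) / e : ℕ) : ℤ)) = e * M := by
      rw [Finset.sum_congr rfl (g := fun _ => (M : ℤ))]
      · simp
      · intro x hx
        rw [Nat.mul_add_div (NeZero.pos e), Nat.div_eq_of_lt (Finset.mem_range.1 hx), add_zero]
    rw [hs]
    push_cast
    ring

open Finset in
/-- Beads lying on a single runner of the abacus occupy distinct positions. -/
lemma runner_card_le (e : ℕ) [NeZero e] {f : ℕ → ℕ} (hf : IsPartition f) (N : ℕ) (i : ZMod e) :
    (#{r ∈ range N | (beta f N r : ZMod e) = i} : ℤ) *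
        (#{r ∈ range N | (beta f N r : ZMod e) = i} - 1) ≤
      2 * ∑ r ∈ range N with (beta f N r : ZMod e) = i, ((beta f N r / e : ℕ) : ℤ) := by
  have hinj : Set.InjOn (fun r => beta f N r / e)
      ({r ∈ range N | (beta f N r : ZMod e) = i} : Finset ℕ) := by
    intro r hr s hs h
    simp only [coe_filter, Set.mem_ofPred_eq] at hr hs
    refine beta_injOn hf N hr.1 hs.1 ?_
    have hmod : beta f N r % e = beta f N s % e :=
      (ZMod.natCast_eq_natCast_iff' _ _ _).1 (hr.2.trans hs.2.symm)
    dsimp only at h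
    rw [← Nat.div_add_mod (beta f N r) e, h, hmod, Nat.div_add_mod]
  have := card_mul_card_sub_one_le_two_mul_sum
    (({r ∈ range N | (beta f N r : ZMod e) = i} : Finset ℕ).image fun r => beta f N r / e)
  rwa [card_image_of_injOn hinj, sum_image hinj] at this

/-- Non-negativity of the weight of a partition. -/
lemma sum_sq_le_two_mul_rowCnt (e : ℕ) [NeZero e] {f : ℕ → ℕ} (hf : IsPartition f) (M : ℕ) :
    ∑ i : ZMod e, (rowCnt e f (e * M) i - rowCnt e f (e * M) (i + 1)) ^ 2 ≤
      2 * rowCnt e f (e * M) 0 := by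
  have hN : ((e * M : ℕ) : ZMod e) = 0 := by simp
  simp_rw [rowCnt_sub e f hN, sum_range_mul_residue]
  rw [rowCnt_zero e f hN, mul_sub, two_mul_sum_range_mul_div]
  set n : ZMod e → ℤ := fun i =>
    ∑ r ∈ Finset.range (e * M), if (beta f (e * M) r : ZMod e) = i then (1 : ℤ) else 0 with hn
  have hsum : ∑ i, n i = e * M := by
    rw [hn, Finset.sum_comm]
    simp
  have hbeta : ∑ i, n i * (n i - 1) ≤
      2 * ∑ r ∈ Finset.range (e * M), ((beta f (e * M) r / e : ℕ) : ℤ) := by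
    rw [← Finset.sum_fiberwise (Finset.range (e * M)) (fun r => (beta f (e * M) r : ZMod e)),
      Finset.mul_sum]
    refine Finset.sum_le_sum fun i _ => ?_
    simpa [hn] using runner_card_le e hf (e * M) i
  have hexp : ∑ i, (n i - M) ^ 2 =
      ∑ i, n i * (n i - 1) - (2 * M - 1) * ∑ i, n i + e * (M : ℤ) ^ 2 := by
    have hc : (e : ℤ) * (M : ℤ) ^ 2 = ∑ _i : ZMod e, (M : ℤ) ^ 2 := by simp [ZMod.card]
    rw [hc, Finset.mul_sum, ← Finset.sum_sub_distrib, ← Finset.sum_add_distrib]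
    exact Finset.sum_congr rfl fun i _ => by ring
  change ∑ i, (n i - M) ^ 2 ≤ _
  rw [hexp, hsum]
  linarith

lemma sum_shift {e : ℕ} [NeZero e] {R : Type*} [AddCommMonoid R] (g : ZMod e → R) (k : ZMod e) :
    ∑ i, g (i + k) = ∑ i, g i :=
  Equiv.sum_comp (Equiv.addRight k) g

lemma sum_range_natCast {e : ℕ} [NeZero e] {R : Type*} [AddCommMonoid R] (g : ZMod e → R) :
    ∑ j ∈ Finset.range e, g j = ∑ i, g i := by
  refine Finset.sum_bij' (fun j _ => (j : ZMod e)) (fun i _ => i.val) ?_ ?_ ?_ ?_ ?_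
  · simp
  · exact fun i _ => Finset.mem_range.2 (ZMod.val_lt i)
  · exact fun j hj => by simp [ZMod.val_natCast, Nat.mod_eq_of_lt (Finset.mem_range.1 hj)]
  · simp
  · simp

lemma sum_sub_succ {e : ℕ} [NeZero e] (A : ZMod e → ℤ) : ∑ i, (A i - A (i + 1)) = 0 := by
  rw [Finset.sum_sub_distrib, sum_shift A 1, sub_self]

lemma even_sum_sq_of_sum_eq_zero {ι : Type*} (s : Finset ι) (x : ι → ℤ) (h : ∑ i ∈ s, x i = 0) :
    Even (∑ i ∈ s, x i ^ 2) := by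
  have : ∑ i ∈ s, x i ^ 2 = ∑ i ∈ s, x i * (x i - 1) := by
    rw [← sub_zero (∑ i ∈ s, x i ^ 2), ← h, ← Finset.sum_sub_distrib]
    exact Finset.sum_congr rfl fun i _ => by ring
  rw [this]
  exact Finset.even_sum _ fun i _ => Int.even_mul_pred_self _

/-- The level two inequality, deduced from the two level one inequalities. -/
lemma sum_sq_add_le {e : ℕ} [NeZero e] (A B : ZMod e → ℤ) (k l : ZMod e)
    (hA : ∑ i, (A i - A (i + 1)) ^ 2 ≤ 2 * A k) (hB : ∑ i, (B i - B (i + 1)) ^ 2 ≤ 2 * B l) :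
    ∑ i, ((A i + B i) - (A (i + 1) + B (i + 1))) ^ 2 ≤ 2 * (A k + B k + (A l + B l)) := by
  set D : ZMod e → ℤ := fun i => A i - B i with hD
  set s := (l - k).val with hs
  have hse : s ≤ e := (ZMod.val_lt _).le
  have hl : (s : ZMod e) + k = l := by simp [hs]
  have htel : D k - D l = ∑ j ∈ Finset.range s, (D (j + k) - D (j + k + 1)) := by
    have := Finset.sum_range_sub' (fun j : ℕ => D (j + k)) s
    simp only [Nat.cast_zero, zero_add, hl] at this
    rw [← this]
    refine Finset.sum_congr rfl fun j _ => ?_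
    push_cast
    rw [add_right_comm]
  have hsq : 2 * (D k - D l) ≤ ∑ i, (D i - D (i + 1)) ^ 2 := by
    have h0 := sum_sub_succ D
    rw [← sum_shift _ k, ← sum_range_natCast, ← Finset.sum_range_add_sum_Ico _ hse] at h0 ⊢
    have h1 : ∑ j ∈ Finset.range s, (D (j + k) - D (j + k + 1)) ≤
        ∑ j ∈ Finset.range s, (D (j + k) - D (j + k + 1)) ^ 2 :=
      Finset.sum_le_sum fun j _ => Int.le_self_sq _
    have h2 : -∑ j ∈ Finset.Ico s e, (D (j + k) - D (j + k + 1)) ≤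
        ∑ j ∈ Finset.Ico s e, (D (j + k) - D (j + k + 1)) ^ 2 := by
      rw [← Finset.sum_neg_distrib]
      exact Finset.sum_le_sum fun j _ => (Int.le_self_sq _).trans_eq (neg_sq _)
    linarith
  have hpar : ∑ i, ((A i + B i) - (A (i + 1) + B (i + 1))) ^ 2 =
      2 * ∑ i, (A i - A (i + 1)) ^ 2 + 2 * ∑ i, (B i - B (i + 1)) ^ 2 -
        ∑ i, (D i - D (i + 1)) ^ 2 := by
    rw [Finset.mul_sum, Finset.mul_sum, ← Finset.sum_add_distrib, ← Finset.sum_sub_distrib]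
    exact Finset.sum_congr rfl fun i _ => by simp only [hD]; ring
  simp only [hD] at hsq hpar
  linarith

lemma cnt_eq_rowCnt (e : ℕ) (κ : Fin 2 → ZMod e) {lam : Fin 2 → ℕ → ℕ}
    (hlam : IsBipartition lam) {N : ℕ} (hN : ∀ a r, N ≤ r → lam a r = 0) (i : ZMod e) :
    (cnt e κ lam i : ℤ) = rowCnt e (lam 0) N (i - κ 0) + rowCnt e (lam 1) N (i - κ 1) := by
  have hle : ∀ a r, lam a r ≤ lam 0 0 + lam 1 0 := by
    intro a r
    have := antitone_nat_of_succ_le (hlam a).1 (Nat.zero_le r)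
    fin_cases a <;> simp at this ⊢ <;> omega
  set K := lam 0 0 + lam 1 0
  have hset : {x : Node | x ∈ Diagram lam ∧ res e κ x = i} =
      ((Finset.range N ×ˢ Finset.range K ×ˢ (Finset.univ : Finset (Fin 2))).filter
        fun x => x.2.1 < lam x.2.2 x.1 ∧ res e κ x = i : Finset Node) := by
    ext ⟨r, c, a⟩
    simp only [Diagram, Set.mem_ofPred_eq, Finset.coe_filter, Finset.mem_product, Finset.mem_range,
      Finset.mem_univ, and_true, iff_and_self]
    rintro ⟨hc, -⟩
    refine ⟨?_, hc.trans_le (hle a r)⟩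
    by_contra! hr
    rw [hN a r hr] at hc
    exact absurd hc (Nat.not_lt_zero _)
  have hrow : ∀ a r, (∑ c ∈ Finset.range K,
      if c < lam a r ∧ res e κ (r, c, a) = i then (1 : ℤ) else 0) =
      ∑ c ∈ Finset.range (lam a r), if (c : ZMod e) - r = i - κ a then (1 : ℤ) else 0 := by
    intro a r
    rw [← Finset.sum_subset (Finset.range_subset_range.2 (hle a r))]
    · refine Finset.sum_congr rfl fun c hc => ?_
      simp [Finset.mem_range.1 hc, res, eq_sub_iff_add_eq]
    · intro c _ hc
      rw [if_neg]
      exact fun h => hc (Finset.mem_range.2 h.1)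
  rw [cnt, hset, Set.ncard_coe_finset, Finset.card_filter]
  push_cast
  rw [Finset.sum_product, rowCnt, rowCnt, ← Finset.sum_add_distrib]
  refine Finset.sum_congr rfl fun r _ => ?_
  rw [Finset.sum_product, ← hrow, ← hrow, ← Finset.sum_add_distrib]
  exact Finset.sum_congr rfl fun c _ => Fin.sum_univ_two _

theorem stmt5 (e : ℕ) (he : 2 ≤ e) (κ : Fin 2 → ZMod e) (lam : Fin 2 → ℕ → ℕ)
    (hlam : IsBipartition lam) :
    ∃ n : ℕ, wt e κ lam = n := by
  have : NeZero e := ⟨by omega⟩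
  obtain ⟨N₀, hN₀⟩ := (hlam 0).2
  obtain ⟨N₁, hN₁⟩ := (hlam 1).2
  set M := N₀ + N₁
  have hM : M ≤ e * M := Nat.le_mul_of_pos_left M (NeZero.pos e)
  have hN : ∀ a r, e * M ≤ r → lam a r = 0 := by
    intro a r hr
    fin_cases a
    · exact hN₀ r (by omega)
    · exact hN₁ r (by omega)
  have hweight : ∀ a, ∑ i : ZMod e, (rowCnt e (lam a) (e * M) (i - κ a) -
      rowCnt e (lam a) (e * M) (i + 1 - κ a)) ^ 2 ≤
        2 * rowCnt e (lam a) (e * M) (κ a - κ a) := by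
    intro a
    rw [sub_self, ← sum_shift _ (κ a)]
    simpa only [add_sub_cancel_right, add_right_comm _ (κ a) 1] using
      sum_sq_le_two_mul_rowCnt e (hlam a) M
  have hcnt := cnt_eq_rowCnt e κ hlam hN
  have hle := sum_sq_add_le (fun i => rowCnt e (lam 0) (e * M) (i - κ 0))
    (fun i => rowCnt e (lam 1) (e * M) (i - κ 1)) (κ 0) (κ 1) (hweight 0) (hweight 1)
  simp only [← hcnt] at hle
  obtain ⟨m, hm⟩ := even_sum_sq_of_sum_eq_zero Finset.univ _
    (sum_sub_succ fun i => (cnt e κ lam i : ℤ))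
  rw [hm] at hle
  obtain ⟨n, hn⟩ := Int.eq_ofNat_of_zero_le
    (show 0 ≤ (cnt e κ lam (κ 0) : ℤ) + cnt e κ lam (κ 1) - m by linarith)
  refine ⟨n, ?_⟩
  have hmq : ∑ i : ZMod e, ((cnt e κ lam i : ℚ) - cnt e κ lam (i + 1)) ^ 2 = m + m := by
    exact_mod_cast hm
  have hnq : (cnt e κ lam (κ 0) : ℚ) + cnt e κ lam (κ 1) - m = n := by exact_mod_cast hn
  rw [wt, sum_range_natCast fun i => ((cnt e κ lam i : ℚ) - cnt e κ lam (i + 1)) ^ 2, hmq, ← hnq]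
  ring

end Wt3
end
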